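/- Let G be a 2-connected [5,3]-graph of order n ≥ 9 with minimum degree at least 3. Then G is Hamiltonian. -/

import Mathlib

def edgesWithin {V : Type*} [DecidableEq V] (G : SimpleGraph V) [DecidableRel G.Adj]
    (A : Finset V) : ℕ := (A.sym2.filter (· ∈ G.edgeSet)).card

/-- `G` is an `[s,t]`-graph: every induced subgraph on `s` vertices has at least `t` edges. -/
def IsSTGraph {V : Type*} [DecidableEq V] (G : SimpleGraph V) [DecidableRel G.Adj]
    (s t : ℕ) : Prop := ∀ A : Finset V, A.card = s → t ≤ edgesWithin G A
/-- `G` is 2-connected: at least 3 vertices and deleting any single vertex leaves it connected. -/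
def TwoConnected {V : Type*} [Fintype V] (G : SimpleGraph V) : Prop :=
  3 ≤ Fintype.card V ∧ ∀ v : V, (G.induce {u : V | u ≠ v}).Connected


open SimpleGraph

section Aux

set_option linter.unusedSectionVars false
set_option linter.unusedSimpArgs false

variable {V : Type*} [DecidableEq V] {G : SimpleGraph V}

/-- `l` is a nonempty list forming a walk from `a` to `b`. -/
def Pt (G : SimpleGraph V) (a : V) (l : List V) (b : V) : Prop :=
  l.IsChain G.Adj ∧ l.head? = some a ∧ l.getLast? = some b

theorem Pt.single (a : V) : Pt G a [a] a := by simp [Pt]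

theorem Pt.append {a b c d : V} {l m : List V} (h1 : Pt G a l b) (h : G.Adj b c)
    (h2 : Pt G c m d) : Pt G a (l ++ m) d := by
  obtain ⟨h1, h3, h4⟩ := h1
  obtain ⟨h2, h5, h6⟩ := h2
  refine ⟨?_, ?_, ?_⟩
  · rw [List.isChain_append]
    refine ⟨h1, h2, ?_⟩
    simp [h4, h5, h]
  · simp [List.head?_append, h3]
  · simp [List.getLast?_append, h6]

theorem Pt.reverse {a b : V} {l : List V} (h1 : Pt G a l b) : Pt G b l.reverse a := by
  obtain ⟨h1, h3, h4⟩ := h1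
  refine ⟨?_, ?_, ?_⟩
  · rw [List.isChain_reverse]
    simpa [G.adj_comm] using h1
  · simp [h4]
  · simp [h3]

theorem Pt.split {a b y : V} {l m : List V} (h : Pt G a (l ++ y :: m) b) (hl : l ≠ []) :
    ∃ c, Pt G a l c ∧ G.Adj c y ∧ Pt G y (y :: m) b := by
  obtain ⟨h1, h3, h4⟩ := h
  rw [List.isChain_append] at h1
  obtain ⟨h5, h6, h7⟩ := h1
  obtain ⟨c, hc⟩ : ∃ c, l.getLast? = some c := ⟨_, List.getLast?_eq_some_getLast hl⟩
  refine ⟨c, ⟨h5, ?_, hc⟩, h7 c hc y (by simp), h6, by simp, ?_⟩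
  · cases l <;> simp_all
  · simpa [List.getLast?_append] using h4

/-- `l` is a cyclic list. -/
def Cyc (G : SimpleGraph V) (l : List V) : Prop :=
  l.Nodup ∧ 3 ≤ l.length ∧ ∀ x ∈ l, G.Adj x (l.formPerm x)

theorem Cyc.rot {l m : List V} (h : Cyc G l) (hr : l ~r m) : Cyc G m := by
  obtain ⟨h1, h2, h3⟩ := h
  refine ⟨hr.nodup_iff.1 h1, hr.perm.length_eq ▸ h2, ?_⟩
  intro x hx
  rw [← List.formPerm_eq_of_isRotated h1 hr]
  exact h3 x (hr.mem_iff.2 hx)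

theorem Cyc.reverse {l : List V} (h : Cyc G l) : Cyc G l.reverse := by
  obtain ⟨h1, h2, h3⟩ := h
  refine ⟨List.nodup_reverse.2 h1, by simpa using h2, ?_⟩
  intro x hx
  rw [List.formPerm_reverse]
  have hx' : l.formPerm (l.formPerm⁻¹ x) ∈ l := by simpa using hx
  have := h3 _ (List.mem_of_formPerm_apply_mem hx')
  simpa using this.symm

theorem Pt.cyc {a b : V} {l : List V} (h : Pt G a l b) (hab : G.Adj b a) (hn : l.Nodup)
    (h3 : 3 ≤ l.length) : Cyc G l := by
  refine ⟨hn, h3, ?_⟩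
  intro x hx
  obtain ⟨i, hi, rfl⟩ := List.getElem_of_mem hx
  rw [List.formPerm_apply_getElem _ hn]
  obtain ⟨h1, h4, h5⟩ := h
  by_cases hi' : i + 1 < l.length
  · have := h1.getElem i hi'
    simpa [Nat.mod_eq_of_lt hi'] using this
  · have e : i + 1 = l.length := by omega
    have e1 : l[i] = b := by
      rw [List.getLast?_eq_getElem?] at h5
      have : l.length - 1 = i := by omega
      rw [this, List.getElem?_eq_getElem hi] at h5
      simpa using h5
    have e2 : l[(i+1) % l.length]'(Nat.mod_lt _ (by omega)) = a := by
      rw [List.head?_eq_getElem?, List.getElem?_eq_getElem (by omega)] at h4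
      simp only [e, Nat.mod_self]
      simpa using h4
    rw [e1, e2]; exact hab

theorem Cyc.pt {a : V} {t : List V} (h : Cyc G (a :: t)) :
    ∃ b, Pt G a (a :: t) b ∧ G.Adj b a := by
  obtain ⟨h1, h2, h3⟩ := h
  refine ⟨(a :: t).getLast (by simp), ⟨?_, by simp, List.getLast?_eq_some_getLast _⟩, ?_⟩
  · rw [List.isChain_iff_getElem]
    intro i hi
    have := h3 _ (List.getElem_mem (l := a :: t) (n := i) (by omega))
    rwa [List.formPerm_apply_lt_getElem _ h1 _ hi] at this
  · have := h3 _ (List.getLast_mem (l := a :: t) (by simp))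
    rwa [List.formPerm_apply_getLast] at this

theorem exists_rot {l : List V} {x : V} (hx : x ∈ l) : ∃ t, l ~r x :: t := by
  obtain ⟨s, t, rfl⟩ := List.append_of_mem hx
  exact ⟨t ++ s, by simpa using List.isRotated_append (l := s) (l' := x :: t)⟩

theorem Cyc.rot1 {l : List V} (h : Cyc G l) {x : V} (hx : x ∈ l) :
    ∃ t, l ~r x :: l.formPerm x :: t := by
  obtain ⟨t, ht⟩ := exists_rot hx
  have h' := h.rot ht
  rcases t with _ | ⟨u, t⟩
  · have := h'.2.1; simp at this
  · have := List.formPerm_apply_head x u t h'.1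
    rw [← List.formPerm_eq_of_isRotated h.1 ht] at this
    exact ⟨t, this ▸ ht⟩

theorem Cyc.rot2 {l : List V} (h : Cyc G l) {x : V} (hx : x ∈ l) :
    ∃ t, l ~r x :: l.formPerm x :: l.formPerm (l.formPerm x) :: t := by
  obtain ⟨t, ht⟩ := h.rot1 hx
  have h' := h.rot ht
  rcases t with _ | ⟨u, t⟩
  · have := h'.2.1; simp at this
  · have := List.formPerm_apply_lt_getElem _ h'.1 1 (by simp)
    rw [← List.formPerm_eq_of_isRotated h.1 ht] at this
    simp at this
    exact ⟨t, by rw [this]; exact ht⟩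

/-- Position of a second vertex on the cycle. -/
theorem succ_of_split {l s t : List V} {x w : V} (hl : l.Nodup)
    (h : l ~r s ++ x :: w :: t) : l.formPerm x = w := by
  have h2 : l ~r x :: w :: (t ++ s) :=
    h.trans (by simpa using List.isRotated_append (l := s) (l' := x :: w :: t))
  rw [List.formPerm_eq_of_isRotated hl h2]
  exact List.formPerm_apply_head _ _ _ (h2.nodup_iff.1 hl)

/-- an off-cycle path -/
def Off (G : SimpleGraph V) (l : List V) (a : V) (q : List V) (b : V) : Prop :=
  Pt G a q b ∧ q.Nodup ∧ ∀ v ∈ q, v ∉ l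

theorem Off.pos {l q : List V} {a b : V} (h : Off G l a q b) : 1 ≤ q.length := by
  rcases q with _ | ⟨_, q⟩
  · have := h.1.2.1; simp at this
  · simp

theorem Off.reverse {l q : List V} {a b : V} (h : Off G l a q b) : Off G l b q.reverse a :=
  ⟨h.1.reverse, List.nodup_reverse.2 h.2.1, by simpa using h.2.2⟩

def Mx (G : SimpleGraph V) (l : List V) : Prop :=
  Cyc G l ∧ ∀ m, Cyc G m → m.length ≤ l.length

theorem Mx.reverse {l : List V} (h : Mx G l) : Mx G l.reverse :=
  ⟨h.1.reverse, by simpa using h.2⟩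

theorem Mx.noInsert {l q : List V} (hM : Mx G l) {x a b : V} (hx : x ∈ l)
    (hq : Off G l a q b) (ha : G.Adj a x) (hb : G.Adj b (l.formPerm x)) : False := by
  obtain ⟨t, ht⟩ := hM.1.rot1 hx
  generalize l.formPerm x = u at *
  have hc := hM.1.rot ht
  obtain ⟨e, he, hex⟩ := hc.pt
  obtain ⟨c, hc1, hc2, hc3⟩ := Pt.split (l := [x]) (m := t) he (by simp)
  have hp := ((Pt.single x).append ha.symm hq.1).append hb hc3
  have hlen := ht.perm.length_eq
  have hnd := hc.1
  have hq3 : ∀ v ∈ q, v ∉ x :: u :: t := fun v hv hv' => hq.2.2 v hv (ht.mem_iff.2 hv')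
  have := hM.2 _ (hp.cyc hex (by
    have := hq.2.1
    simp only [List.nodup_append, List.nodup_cons] at *
    grind) (by have := hc.2.1; simp at *; omega))
  have := hq.pos
  simp at *
  omega

theorem Mx.noSkip {l q : List V} (hM : Mx G l) {x a b : V} (hx : x ∈ l)
    (hq : Off G l a q b) (hq2 : 2 ≤ q.length) (ha : G.Adj a x)
    (hb : G.Adj b (l.formPerm (l.formPerm x))) : False := by
  obtain ⟨t, ht⟩ := hM.1.rot2 hx
  generalize l.formPerm (l.formPerm x) = u' at *
  generalize l.formPerm x = u at *
  have hc := hM.1.rot ht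
  obtain ⟨e, he, hex⟩ := hc.pt
  obtain ⟨c, hc1, hc2, hc3⟩ := Pt.split (l := [x, u]) (m := t) he (by simp)
  have hp := ((Pt.single x).append ha.symm hq.1).append hb hc3
  have hlen := ht.perm.length_eq
  have hnd := hc.1
  have hq3 : ∀ v ∈ q, v ∉ x :: u :: u' :: t := fun v hv hv' => hq.2.2 v hv (ht.mem_iff.2 hv')
  have := hM.2 _ (hp.cyc hex (by
    have := hq.2.1
    simp only [List.nodup_append, List.nodup_cons] at *
    grind) (by have := hc.2.1; simp at *; omega))
  simp at *
  omega

theorem Cyc.split {l : List V} (h : Cyc G l) {x x' : V} (hx : x ∈ l) (hx' : x' ∈ l)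
    (hne : x ≠ x') (h1 : l.formPerm x ≠ x') (h2 : l.formPerm x' ≠ x) :
    ∃ s t, l ~r x :: l.formPerm x :: s ++ x' :: l.formPerm x' :: t := by
  obtain ⟨r, hr⟩ := h.rot1 hx
  have hm : x' ∈ r := by
    have := hr.mem_iff.1 hx'
    simp at this
    grind
  obtain ⟨s, t, rfl⟩ := List.append_of_mem hm
  rcases t with _ | ⟨w, t⟩
  · exfalso
    apply h2
    rw [List.formPerm_eq_of_isRotated h.1 hr]
    exact List.formPerm_cons_concat_apply_last x x' (l.formPerm x :: s)
  · have := succ_of_split (s := x :: l.formPerm x :: s) h.1 (by simpa using hr)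
    exact ⟨s, t, by rw [this]; simpa using hr⟩

theorem Mx.noCross {l q : List V} (hM : Mx G l) {x x' a b : V} (hx : x ∈ l) (hx' : x' ∈ l)
    (hne : x ≠ x') (hq : Off G l a q b) (ha : G.Adj a x) (hb : G.Adj b x') :
    ¬ G.Adj (l.formPerm x) (l.formPerm x') := by
  intro hadj
  obtain ⟨s, t, ht⟩ := hM.1.split hx hx' hne
    (fun h => hM.noInsert hx hq ha (h ▸ hb)) (fun h => hM.noInsert hx' hq.reverse hb (h ▸ ha))
  generalize l.formPerm x = u at *
  generalize l.formPerm x' = w at *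
  have hc := hM.1.rot ht
  obtain ⟨e, he, hex⟩ := hc.pt
  obtain ⟨c, hc1, hc2, hc3⟩ := Pt.split (l := [x]) (m := s ++ x' :: w :: t) he (by simp)
  obtain ⟨c', hc1', hc2', hc3'⟩ := Pt.split (l := u :: s ++ [x']) (y := w) (m := t)
    (by simpa using hc3) (by simp)
  have e : c' = x' := by
    have h9 := hc1'.2.2
    rw [List.getLast?_append] at h9
    simpa using h9.symm
  subst e
  have hp := (((Pt.single x).append ha.symm hq.1).append hb hc1'.reverse).append hadj hc3'
  have hlen := ht.perm.length_eq
  have hnd := hc.1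
  have hq3 : ∀ v ∈ q, v ∉ x :: u :: s ++ c' :: w :: t := fun v hv hv' =>
    hq.2.2 v hv (ht.mem_iff.2 hv')
  have := hM.2 _ (hp.cyc hex (by
    have := hq.2.1
    simp only [List.cons_append, List.nodup_append, List.nodup_cons, List.nodup_reverse] at *
    grind) (by have := hc.2.1; simp at *; omega))
  have := hq.pos
  simp at *
  omega

theorem Mx.exchange {l q : List V} (hM : Mx G l) {x x' a b : V} (hx : x ∈ l) (hx' : x' ∈ l)
    (hne : x ≠ x') (hq : Off G l a q b) (ha : G.Adj a x) (hb : G.Adj b x')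
    (h2 : l.formPerm (l.formPerm x) ≠ x')
    (hadj : G.Adj (l.formPerm (l.formPerm x)) (l.formPerm x')) :
    ∃ m, Cyc G m ∧ m.length + 1 = l.length + q.length ∧ l.formPerm x ∉ m := by
  obtain ⟨s, t, ht⟩ := hM.1.split hx hx' hne
    (fun h => hM.noInsert hx hq ha (h ▸ hb)) (fun h => hM.noInsert hx' hq.reverse hb (h ▸ ha))
  have hs : ∃ s', s = l.formPerm (l.formPerm x) :: s' := by
    rcases s with _ | ⟨y, s⟩
    · exact absurd (succ_of_split (s := [x]) hM.1.1 (by simpa using ht)) h2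
    · exact ⟨s, by rw [succ_of_split (s := [x]) (w := y) hM.1.1 (by simpa using ht)]⟩
  obtain ⟨s, rfl⟩ := hs
  generalize l.formPerm (l.formPerm x) = u' at *
  generalize l.formPerm x = u at *
  generalize l.formPerm x' = w at *
  have hc := hM.1.rot ht
  obtain ⟨e, he, hex⟩ := hc.pt
  obtain ⟨c, hc1, hc2, hc3⟩ := Pt.split (l := [x, u]) (m := s ++ x' :: w :: t) he (by simp)
  obtain ⟨c', hc1', hc2', hc3'⟩ := Pt.split (l := u' :: s ++ [x']) (y := w) (m := t)
    (by simpa using hc3) (by simp)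
  have e : c' = x' := by
    have h9 := hc1'.2.2
    rw [List.getLast?_append] at h9
    simpa using h9.symm
  subst e
  have hp := (((Pt.single x).append ha.symm hq.1).append hb hc1'.reverse).append hadj hc3'
  have hlen := ht.perm.length_eq
  have hnd := hc.1
  have hq3 : ∀ v ∈ q, v ∉ x :: u :: u' :: s ++ c' :: w :: t := fun v hv hv' =>
    hq.2.2 v hv (ht.mem_iff.2 hv')
  refine ⟨_, hp.cyc hex ?_ ?_, ?_, ?_⟩
  · have := hq.2.1
    simp only [List.cons_append, List.nodup_append, List.nodup_cons, List.nodup_reverse] at *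
    grind
  · have := hc.2.1; have := hq.pos; simp at *; omega
  · simp at *; omega
  · simp only [List.cons_append, List.nodup_append, List.nodup_cons, List.nodup_reverse] at *
    grind

/-- the graph of off-cycle edges -/
def offG (G : SimpleGraph V) (l : List V) : SimpleGraph V where
  Adj a b := G.Adj a b ∧ a ∉ l ∧ b ∉ l
  symm := ⟨fun _ _ h => ⟨h.1.symm, h.2.2, h.2.1⟩⟩
  loopless := ⟨fun _ h => G.loopless.irrefl _ h.1⟩

theorem off_support {l : List V} {a b : V} (p : (offG G l).Walk a b) (ha : a ∉ l) :
    ∀ v ∈ p.support, v ∉ l := by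
  induction p with
  | nil => simpa using ha
  | cons h p ih =>
    intro v hv
    simp only [Walk.support_cons, List.mem_cons] at hv
    rcases hv with rfl | hv
    · exact ha
    · exact ih h.2.2 v hv

theorem off_path {l : List V} {a b : V} (h : (offG G l).Reachable a b) (ha : a ∉ l) :
    ∃ q, Off G l a q b ∧ (a ≠ b → 2 ≤ q.length) := by
  obtain ⟨p, hp⟩ := h.exists_isPath
  refine ⟨p.support, ⟨⟨?_, ?_, ?_⟩, hp.support_nodup, off_support p ha⟩, ?_⟩
  · exact p.isChain_adj_support.imp (fun _ _ h => h.1)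
  · rw [List.head?_eq_some_head p.support_ne_nil, p.head_support]
  · rw [List.getLast?_eq_some_getLast p.support_ne_nil, p.getLast_support]
  · intro hab
    rw [Walk.length_support]
    have : p.length ≠ 0 := fun h0 => hab (Walk.eq_of_length_eq_zero h0)
    omega

theorem Off.refl {l : List V} {a : V} (ha : a ∉ l) : Off G l a [a] a :=
  ⟨Pt.single a, by simp, by simpa using ha⟩

theorem Mx.noInsertR {l : List V} (hM : Mx G l) {x a b : V} (hx : x ∈ l) (ha' : a ∉ l)
    (hab : (offG G l).Reachable a b) (ha : G.Adj a x) : ¬ G.Adj b (l.formPerm x) := by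
  obtain ⟨q, hq, -⟩ := off_path hab ha'
  exact fun h => hM.noInsert hx hq ha h

theorem Mx.noCrossR {l : List V} (hM : Mx G l) {x x' a b : V} (hx : x ∈ l) (hx' : x' ∈ l)
    (hne : x ≠ x') (ha' : a ∉ l)
    (hab : (offG G l).Reachable a b) (ha : G.Adj a x) (hb : G.Adj b x') :
    ¬ G.Adj (l.formPerm x) (l.formPerm x') := by
  obtain ⟨q, hq, -⟩ := off_path hab ha'
  exact hM.noCross hx hx' hne hq ha hb

theorem five [DecidableRel G.Adj] (hst : IsSTGraph G 5 3) {a b c d e : V}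
    (h : [a, b, c, d, e].Nodup) :
    3 ≤ (if G.Adj a b then 1 else 0) + (if G.Adj a c then 1 else 0) +
      (if G.Adj a d then 1 else 0) + (if G.Adj a e then 1 else 0) +
      (if G.Adj b c then 1 else 0) + (if G.Adj b d then 1 else 0) +
      (if G.Adj b e then 1 else 0) + (if G.Adj c d then 1 else 0) +
      (if G.Adj c e then 1 else 0) + (if G.Adj d e then 1 else 0) := by
  have h1 := hst [a, b, c, d, e].toFinset (by rw [List.toFinset_card_of_nodup h]; rfl)
  refine h1.trans ?_
  unfold edgesWithin
  let L : List (Sym2 V) := [s(a, b), s(a, c), s(a, d), s(a, e), s(b, c), s(b, d), s(b, e), s(c, d),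
    s(c, e), s(d, e)]
  have hsub : ([a, b, c, d, e].toFinset.sym2.filter (· ∈ G.edgeSet)) ⊆
      (L.filter (fun z => z ∈ G.edgeSet)).toFinset := by
    intro z hz
    induction z using Sym2.ind with
    | _ x y =>
      rw [Finset.mem_filter, Finset.mk_mem_sym2_iff] at hz
      obtain ⟨⟨hx, hy⟩, hxy⟩ := hz
      have hne : x ≠ y := G.ne_of_adj hxy
      have hL : s(x, y) ∈ L := by
        simp only [List.mem_toFinset, List.mem_cons, List.not_mem_nil, or_false] at hx hy
        simp only [L, List.mem_cons, List.not_mem_nil, or_false, Sym2.eq_iff]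
        grind
      simp only [List.mem_toFinset, List.mem_filter, decide_eq_true_eq]
      exact ⟨hL, hxy⟩
  refine (Finset.card_le_card hsub).trans ((List.toFinset_card_le _).trans ?_)
  rw [← List.countP_eq_length_filter]
  simp only [L, List.countP_cons, List.countP_nil, mem_edgeSet, decide_eq_true_eq]
  omega

theorem exit_edge [Fintype V] (h2 : TwoConnected G) {l : List V} (hl : Cyc G l) {u v z : V}
    (hu : u ∉ l) (hv : (offG G l).Reachable u v) (hvz : v ≠ z) :
    ∃ h x, (offG G l).Reachable u h ∧ x ∈ l ∧ h ≠ z ∧ x ≠ z ∧ G.Adj h x := by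
  have off : ∀ w, (offG G l).Reachable u w → w ∉ l := by
    rintro w ⟨p⟩
    exact off_support p hu w p.end_mem_support
  obtain ⟨w, hw, hwz⟩ : ∃ w ∈ l, w ≠ z := by
    obtain ⟨hn, h3, -⟩ := hl
    match l, hn, h3 with
    | a :: b :: t, hn, _ =>
      by_cases h : a = z
      · exact ⟨b, by simp, by simp at hn; grind⟩
      · exact ⟨a, by simp, h⟩
  obtain ⟨p⟩ := (h2.2 z).preconnected ⟨v, hvz⟩ ⟨w, hwz⟩
  obtain ⟨d, -, hd1, hd2⟩ := p.exists_boundary_dart {y | (offG G l).Reachable u y.1} hv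
    (fun h => off w h hw)
  have hadj : G.Adj d.fst.1 d.snd.1 := d.adj
  refine ⟨d.fst.1, d.snd.1, hd1, ?_, d.fst.2, d.snd.2, hadj⟩
  by_contra hc
  have h3 : (offG G l).Adj d.fst.1 d.snd.1 := ⟨hadj, off _ hd1, hc⟩
  exact hd2 (Reachable.trans hd1 h3.reachable)

theorem pair_edge [Fintype V] (h2 : TwoConnected G) {l : List V} (hl : Cyc G l) {u u' : V}
    (hu : u ∉ l) (hu' : u' ∉ l) (huu : G.Adj u u') :
    ∃ h x h' x', (offG G l).Reachable u h ∧ (offG G l).Reachable u h' ∧ x ∈ l ∧ x' ∈ l ∧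
      h ≠ h' ∧ x ≠ x' ∧ G.Adj h x ∧ G.Adj h' x' := by
  have hR : (offG G l).Reachable u u' := Adj.reachable (show (offG G l).Adj u u' from ⟨huu, hu, hu'⟩)
  obtain ⟨h1, x1, r1, m1, -, -, a1⟩ := exit_edge h2 hl hu (Reachable.refl u) huu.ne
  have : ∃ v, (offG G l).Reachable u v ∧ v ≠ h1 := by
    by_cases h : u = h1
    · exact ⟨u', hR, by rintro rfl; exact huu.ne h⟩
    · exact ⟨u, Reachable.refl u, h⟩
  obtain ⟨v, hv, hvne⟩ := this
  obtain ⟨h2', x2, r2, m2, n2, -, a2⟩ := exit_edge h2 hl hu hv hvne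
  by_cases hx : x2 = x1
  · subst hx
    obtain ⟨h3, x3, r3, m3, -, n3, a3⟩ := exit_edge h2 hl hu (Reachable.refl u)
      (z := x2) (by rintro rfl; exact hu m2)
    by_cases h31 : h3 = h1
    · exact ⟨h3, x3, h2', x2, r3, r2, m3, m2, by rw [h31]; exact n2.symm, n3, a3, a2⟩
    · exact ⟨h3, x3, h1, x2, r3, r1, m3, m2, h31, n3, a3, a1⟩
  · exact ⟨h2', x2, h1, x1, r2, r1, m2, m1, n2, hx, a2, a1⟩

theorem Mx.iso [Fintype V] [DecidableRel G.Adj] (h2 : TwoConnected G) (hst : IsSTGraph G 5 3)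
    {l : List V} (hM : Mx G l) {u u' : V} (hu : u ∉ l) (hu' : u' ∉ l) : ¬ G.Adj u u' := by
  intro huu
  obtain ⟨h, x, h', x', rh, rh', mx, mx', nh, nx, ax, ax'⟩ := pair_edge h2 hM.1 hu hu' huu
  have off : ∀ w, (offG G l).Reachable u w → w ∉ l := by
    rintro w ⟨p⟩
    exact off_support p hu w p.end_mem_support
  have r : ∀ {a b}, (offG G l).Reachable u a → (offG G l).Reachable u b →
    (offG G l).Reachable a b := fun h1 h2 => h1.symm.trans h2
  have ms : ∀ {y}, y ∈ l → l.formPerm y ∈ l := fun h => List.formPerm_apply_mem_of_mem h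
  -- no edges from the component to a successor
  have E1 : ∀ a b y, (offG G l).Reachable u a → (offG G l).Reachable u b → y ∈ l → G.Adj a y →
      ¬ G.Adj b (l.formPerm y) := fun a b y ha hb hy hay =>
    hM.noInsertR hy (off _ ha) (r ha hb) hay
  have E2 : ∀ a b y y', (offG G l).Reachable u a → (offG G l).Reachable u b → y ∈ l → y' ∈ l →
      y ≠ y' → G.Adj a y → G.Adj b y' →
      ¬ G.Adj (l.formPerm y) (l.formPerm y') := fun a b y y' ha hb hy hy' hne hay hby =>
    hM.noCrossR hy hy' hne (off _ ha) (r ha hb) hay hby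
  have ne : ∀ a y, (offG G l).Reachable u a → y ∈ l → a ≠ y := by
    rintro a y ha hy rfl; exact off _ ha hy
  have inj : ∀ {y y'}, y ≠ y' → l.formPerm y ≠ l.formPerm y' := fun hne h => hne (l.formPerm.injective h)
  -- only two attachments
  have two : ∀ a y, (offG G l).Reachable u a → y ∈ l → G.Adj a y → y = x ∨ y = x' := by
    intro a y ha hy hay
    by_contra hc
    push Not at hc
    have := five hst (a := h) (b := h') (c := l.formPerm x) (d := l.formPerm x')
      (e := l.formPerm y) (by
        have := ne h _ rh (ms mx)
        have := ne h _ rh (ms mx')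
        have := ne h _ rh (ms hy)
        have := ne h' _ rh' (ms mx)
        have := ne h' _ rh' (ms mx')
        have := ne h' _ rh' (ms hy)
        have := inj nx
        have := inj hc.1.symm
        have := inj hc.2.symm
        simp; grind)
    rw [if_neg (E1 _ _ _ rh rh mx ax), if_neg (E1 _ _ _ rh rh' mx ax),
      if_neg (E1 _ _ _ rh' rh mx' ax'), if_neg (E1 _ _ _ rh' rh' mx' ax'),
      if_neg (E1 _ _ _ ha rh hy hay), if_neg (E1 _ _ _ ha rh' hy hay),
      if_neg (E2 _ _ _ _ rh rh' mx mx' nx ax ax'),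
      if_neg (E2 _ _ _ _ rh ha mx hy hc.1.symm ax hay),
      if_neg (E2 _ _ _ _ rh' ha mx' hy hc.2.symm ax' hay)] at this
    split_ifs at this <;> omega
  obtain ⟨q, hq, hq2⟩ := off_path (r rh rh') (off _ rh)
  have hq2 := hq2 nh
  have n1 : l.formPerm (l.formPerm x) ≠ x' := fun e => hM.noSkip mx hq hq2 ax (e ▸ ax')
  have n2 : l.formPerm (l.formPerm x) ≠ x := by
    obtain ⟨t, ht⟩ := hM.1.rot2 mx
    have := ht.nodup_iff.1 hM.1.1
    simp at this
    grind
  have n3 : l.formPerm x ≠ x' := fun e => E1 _ _ _ rh rh' mx ax (e ▸ ax')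
  have n4 : l.formPerm x ≠ x := (hM.1.2.2 x mx).ne'
  have n5 : ∀ a, (offG G l).Reachable u a → ¬ G.Adj a (l.formPerm (l.formPerm x)) := by
    intro a ha hadj
    rcases two a _ ha (ms (ms mx)) hadj with h | h
    · exact n2 h
    · exact n1 h
  have n6 : ¬ G.Adj (l.formPerm (l.formPerm x)) (l.formPerm x') := by
    intro hadj
    obtain ⟨m, hm, hlen, -⟩ := hM.exchange mx mx' nx hq ax ax' n1 hadj
    have := hM.2 m hm
    omega
  have := five hst (a := h) (b := h') (c := l.formPerm x) (d := l.formPerm (l.formPerm x))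
      (e := l.formPerm x') (by
        have := ne h _ rh (ms mx)
        have := ne h _ rh (ms mx')
        have := ne h _ rh (ms (ms mx))
        have := ne h' _ rh' (ms mx)
        have := ne h' _ rh' (ms mx')
        have := ne h' _ rh' (ms (ms mx))
        have := inj nx
        have := inj n3
        have := inj n4
        simp; grind)
  rw [if_neg (E1 _ _ _ rh rh mx ax), if_neg (E1 _ _ _ rh rh' mx ax),
      if_neg (E1 _ _ _ rh' rh mx' ax'), if_neg (E1 _ _ _ rh' rh' mx' ax'),
      if_neg (n5 h rh), if_neg (n5 h' rh'),
      if_neg (E2 _ _ _ _ rh rh' mx mx' nx ax ax'), if_neg n6] at this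
  split_ifs at this <;> omega

theorem Mx.deg3 [Fintype V] [DecidableRel G.Adj] (h2 : TwoConnected G) (hst : IsSTGraph G 5 3)
    {l : List V} (hM : Mx G l) {h x y z w : V} (hh : h ∉ l) (hd : [x, y, z, w].Nodup)
    (hx : G.Adj h x) (hy : G.Adj h y) (hz : G.Adj h z) (hw : G.Adj h w) : False := by
  have on : ∀ {v}, G.Adj h v → v ∈ l := fun hv => by
    by_contra hc; exact hM.iso h2 hst hh hc hv
  have E1 : ∀ {v}, G.Adj h v → ¬ G.Adj h (l.formPerm v) := fun hv hv' =>
    hM.noInsert (on hv) (Off.refl hh) hv hv'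
  have E2 : ∀ {v v'}, v ≠ v' → G.Adj h v → G.Adj h v' →
      ¬ G.Adj (l.formPerm v) (l.formPerm v') := fun hne hv hv' =>
    hM.noCross (on hv) (on hv') hne (Off.refl hh) hv hv'
  have ne : ∀ {v}, G.Adj h v → h ≠ l.formPerm v := by
    intro v hv e
    exact hh (e ▸ List.formPerm_apply_mem_of_mem (on hv))
  simp only [List.nodup_cons, List.mem_cons, List.not_mem_nil, or_false, not_or] at hd
  obtain ⟨⟨d1, d2, d3⟩, ⟨d4, d5⟩, d6, -⟩ := hd
  have := five hst (a := h) (b := l.formPerm x) (c := l.formPerm y) (d := l.formPerm z)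
    (e := l.formPerm w) (by
      simp [ne hx, ne hy, ne hz, ne hw, d1, d2, d3, d4, d5, d6])
  rw [if_neg (E1 hx), if_neg (E1 hy), if_neg (E1 hz), if_neg (E1 hw), if_neg (E2 d1 hx hy),
    if_neg (E2 d2 hx hz), if_neg (E2 d3 hx hw), if_neg (E2 d4 hy hz), if_neg (E2 d5 hy hw),
    if_neg (E2 d6 hz hw)] at this
  omega

theorem Mx.all3 [Fintype V] [DecidableRel G.Adj] (h2 : TwoConnected G) (hst : IsSTGraph G 5 3)
    {l : List V} (hM : Mx G l) {h x y z : V} (hh : h ∉ l) (d1 : x ≠ y) (d2 : x ≠ z) (d3 : y ≠ z)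
    (hx : G.Adj h x) (hy : G.Adj h y) (hz : G.Adj h z) {v : V} (hv : v ≠ h) (hvh : ¬ G.Adj h v)
    (vx : v ≠ l.formPerm x) (vy : v ≠ l.formPerm y) (vz : v ≠ l.formPerm z) :
    G.Adj v (l.formPerm x) ∧ G.Adj v (l.formPerm y) ∧ G.Adj v (l.formPerm z) := by
  have on : ∀ {v}, G.Adj h v → v ∈ l := fun hv => by
    by_contra hc; exact hM.iso h2 hst hh hc hv
  have E1 : ∀ {v}, G.Adj h v → ¬ G.Adj h (l.formPerm v) := fun hv hv' =>
    hM.noInsert (on hv) (Off.refl hh) hv hv'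
  have E2 : ∀ {v v'}, v ≠ v' → G.Adj h v → G.Adj h v' →
      ¬ G.Adj (l.formPerm v) (l.formPerm v') := fun hne hv hv' =>
    hM.noCross (on hv) (on hv') hne (Off.refl hh) hv hv'
  have ne : ∀ {v}, G.Adj h v → h ≠ l.formPerm v := by
    intro v hv e
    exact hh (e ▸ List.formPerm_apply_mem_of_mem (on hv))
  have := five hst (a := h) (b := v) (c := l.formPerm x) (d := l.formPerm y)
    (e := l.formPerm z) (by
      simp [ne hx, ne hy, ne hz, d1, d2, d3, vx, vy, vz, hv.symm])
  rw [if_neg (E1 hx), if_neg (E1 hy), if_neg (E1 hz), if_neg (E2 d1 hx hy),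
    if_neg (E2 d2 hx hz), if_neg (E2 d3 hy hz), if_neg hvh] at this
  split_ifs at this <;> first | omega | (refine ⟨?_, ?_, ?_⟩ <;> assumption)

theorem Mx.spans [Fintype V] [DecidableRel G.Adj] (h2 : TwoConnected G) (hst : IsSTGraph G 5 3)
    (hn : 9 ≤ Fintype.card V) (hδ : ∀ v : V, 3 ≤ G.degree v)
    {l : List V} (hM : Mx G l) (h : V) : h ∈ l := by
  by_contra hh
  obtain ⟨N, hN, hN3⟩ := Finset.exists_subset_card_eq (hδ h)
  obtain ⟨x, y, z, d1, d2, d3, rfl⟩ := Finset.card_eq_three.1 hN3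
  have hx : G.Adj h x := by simpa using hN (show x ∈ _ by simp)
  have hy : G.Adj h y := by simpa using hN (show y ∈ _ by simp)
  have hz : G.Adj h z := by simpa using hN (show z ∈ _ by simp)
  have only : ∀ v, G.Adj h v → v = x ∨ v = y ∨ v = z := by
    intro v hv
    by_contra hc
    push Not at hc
    exact hM.deg3 h2 hst hh (by simp; grind) hx hy hz hv
  have on : ∀ {v}, G.Adj h v → v ∈ l := fun hv => by
    by_contra hc; exact hM.iso h2 hst hh hc hv
  have hMr := hM.reverse
  have hhr : h ∉ l.reverse := by simpa using hh
  have onr : ∀ {v}, G.Adj h v → v ∈ l.reverse := fun hv => by simpa using on hv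
  have E1 : ∀ {v}, G.Adj h v → ¬ G.Adj h (l.formPerm v) := fun hv hv' =>
    hM.noInsert (on hv) (Off.refl hh) hv hv'
  have F2 : ∀ {v v'}, v ≠ v' → G.Adj h v → G.Adj h v' →
      ¬ G.Adj (l.formPerm⁻¹ v) (l.formPerm⁻¹ v') := fun hne hv hv' => by
    rw [← List.formPerm_reverse]
    exact hMr.noCross (onr hv) (onr hv') hne (Off.refl hhr) hv hv'
  have F1 : ∀ {v}, G.Adj h v → ¬ G.Adj h (l.formPerm⁻¹ v) := fun hv hv' => by
    rw [← List.formPerm_reverse] at hv'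
    exact hMr.noInsert (onr hv) (Off.refl hhr) hv hv'
  have Y : ∀ v, v ≠ h → ¬ G.Adj h v → (∀ w, G.Adj h w → v ≠ l.formPerm w) →
      ∀ w, G.Adj h w → G.Adj v (l.formPerm w) := by
    intro v hv hvh hvw w hw
    have := hM.all3 h2 hst hh d1 d2 d3 hx hy hz hv hvh (hvw x hx) (hvw y hy) (hvw z hz)
    rcases only w hw with rfl | rfl | rfl
    exacts [this.1, this.2.1, this.2.2]
  have ms : ∀ {y}, y ∈ l → l.formPerm y ∈ l := fun h => List.formPerm_apply_mem_of_mem h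
  have mp : ∀ {y}, y ∈ l → l.formPerm⁻¹ y ∈ l := fun {y} h => by
    apply List.mem_of_formPerm_apply_mem
    simpa using h
  have neh : ∀ {v}, v ∈ l → v ≠ h := by rintro v hv rfl; exact hh hv
  by_cases hcase : ∃ j, G.Adj h j ∧ ∀ w, G.Adj h w → l.formPerm⁻¹ j ≠ l.formPerm w
  · obtain ⟨j, hj, hjw⟩ := hcase
    have hp := Y _ (neh (mp (on hj))) (F1 hj) hjw
    have disj : ∀ k m, G.Adj h k → G.Adj h m → l.formPerm⁻¹ m ≠ l.formPerm k := by
      intro k m hk hm e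
      have hjm : j ≠ m := by
        rintro rfl
        exact hjw k hk e
      exact F2 hjm hj hm (e ▸ hp k hk)
    have hq : ∀ m, G.Adj h m → G.Adj (l.formPerm⁻¹ m) (l.formPerm x) := fun m hm =>
      Y _ (neh (mp (on hm))) (F1 hm) (fun w hw => disj w m hw hm) x hx
    have n1 : ∀ m, G.Adj h m → l.formPerm (l.formPerm x) ≠ m := by
      intro m hm e
      apply disj x m hx hm
      rw [← e]; simp
    have hadj : G.Adj (l.formPerm (l.formPerm x)) (l.formPerm y) := by
      refine Y _ (neh (ms (ms (on hx)))) (fun hc => n1 _ hc rfl) ?_ y hy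
      intro w hw e
      have := l.formPerm.injective e
      exact E1 hx (this ▸ hw)
    obtain ⟨m, hm, hlen, hxm⟩ := hM.exchange (on hx) (on hy) d1 (Off.refl hh) hx hy
      (n1 y hy) hadj
    have hlen' : m.length = l.length := by simpa using hlen
    have hMm : Mx G m := ⟨hm, fun k hk => hlen' ▸ hM.2 k hk⟩
    have nx : ∀ m, G.Adj h m → x ≠ l.formPerm⁻¹ m := by
      rintro m hm e
      exact F1 hm (e ▸ hx)
    refine hMm.deg3 h2 hst hxm (x := x) (y := l.formPerm⁻¹ x) (z := l.formPerm⁻¹ y)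
      (w := l.formPerm⁻¹ z) ?_ (hM.1.2.2 x (on hx)).symm (hq x hx).symm (hq y hy).symm
      (hq z hz).symm
    have := nx x hx
    have := nx y hy
    have := nx z hz
    have e1 : l.formPerm⁻¹ x ≠ l.formPerm⁻¹ y := fun e => d1 (Equiv.injective _ e)
    have e2 : l.formPerm⁻¹ x ≠ l.formPerm⁻¹ z := fun e => d2 (Equiv.injective _ e)
    have e3 : l.formPerm⁻¹ y ≠ l.formPerm⁻¹ z := fun e => d3 (Equiv.injective _ e)
    simp only [List.nodup_cons, List.mem_cons, List.not_mem_nil, or_false, not_or,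
      not_false_eq_true, List.nodup_nil, and_true]
    exact ⟨⟨‹_›, ‹_›, ‹_›⟩, ⟨e1, e2⟩, e3⟩
  · push Not at hcase
    have key : ∀ v ∈ l, G.Adj h v ∨ ∃ w, G.Adj h w ∧ v = l.formPerm w := by
      have nf : ∀ v ∈ l, l.reverse.formPerm v ≠ v := fun v hv =>
        (hMr.1.2.2 v (by simpa using hv)).ne'
      have hcyc := List.isCycle_formPerm hMr.1.1 (by have := hMr.1.2.1; omega)
      intro v hv
      obtain ⟨i, rfl⟩ := hcyc.exists_pow_eq (nf x (on hx)) (nf v hv)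
      clear hv
      induction i with
      | zero => left; simpa using hx
      | succ i ih =>
        rw [pow_succ', Equiv.Perm.mul_apply]
        rw [List.formPerm_reverse] at ih ⊢
        rcases ih with ih | ⟨w, hw, ih⟩
        · right; exact hcase _ ih
        · left; rw [ih]; simpa using hw
    have far : ∀ T : Finset V, T.card ≤ 8 → ∃ v, v ∉ T := by
      intro T hT
      by_contra hc
      push Not at hc
      have : T = Finset.univ := Finset.eq_univ_iff_forall.2 hc
      rw [this, Finset.card_univ] at hT
      omega
    have offl : ∀ v, v ∉ ({x, y, z, l.formPerm x, l.formPerm y, l.formPerm z} : Finset V) →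
        v ∉ l ∧ ¬ G.Adj h v ∧ (∀ w, G.Adj h w → v ≠ l.formPerm w) := by
      intro v hv
      simp only [Finset.mem_insert, Finset.mem_singleton, not_or] at hv
      have a1 : ¬ G.Adj h v := fun hc => by have := only v hc; grind
      have a2 : ∀ w, G.Adj h w → v ≠ l.formPerm w := by
        intro w hw
        rcases only w hw with rfl | rfl | rfl
        exacts [hv.2.2.2.1, hv.2.2.2.2.1, hv.2.2.2.2.2]
      refine ⟨fun hc => ?_, a1, a2⟩
      rcases key v hc with h1 | ⟨w, hw, h1⟩
      · exact a1 h1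
      · exact a2 w hw h1
    obtain ⟨h', hh'⟩ := far (insert h {x, y, z, l.formPerm x, l.formPerm y, l.formPerm z})
      ((Finset.card_insert_le _ _).trans (by have := Finset.card_le_six (a := x) (b := y) (c := z) (d := l.formPerm x) (e := l.formPerm y) (f := l.formPerm z); omega))
    obtain ⟨k, hk⟩ := far (insert h' (insert h
      {x, y, z, l.formPerm x, l.formPerm y, l.formPerm z}))
      ((Finset.card_insert_le _ _).trans (by
        have := Finset.card_insert_le h {x, y, z, l.formPerm x, l.formPerm y, l.formPerm z}
        have := Finset.card_le_six (a := x) (b := y) (c := z) (d := l.formPerm x) (e := l.formPerm y) (f := l.formPerm z)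
        omega))
    rw [Finset.mem_insert, not_or] at hh' hk
    rw [Finset.mem_insert, not_or] at hk
    obtain ⟨o1, o2, o3⟩ := offl h' hh'.2
    obtain ⟨p1, p2, p3⟩ := offl k hk.2.2
    have A := Y h' hh'.1 o2 o3
    have B := Y k hk.2.1 p2 p3
    have inj : ∀ {y y'}, y ≠ y' → l.formPerm y ≠ l.formPerm y' :=
      fun hne h => hne (l.formPerm.injective h)
    have nek : ∀ {v}, v ∈ l → k ≠ v := by rintro v hv rfl; exact p1 hv
    have := hM.all3 h2 hst o1 (inj d1) (inj d2) (inj d3) (A x hx) (A y hy) (A z hz)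
      (v := k) hk.1 (hM.iso h2 hst o1 p1) (nek (ms (ms (on hx)))) (nek (ms (ms (on hy))))
      (nek (ms (ms (on hz))))
    exact hM.noInsert (ms (on hx)) (Off.refl p1) (B x hx) this.1

theorem exists_cyc [Fintype V] [DecidableRel G.Adj] (h2 : TwoConnected G)
    (hn : 9 ≤ Fintype.card V) (hδ : ∀ v : V, 3 ≤ G.degree v) : ∃ l, Cyc G l := by
  have hne : Nonempty V := Fintype.card_pos_iff.1 (by omega)
  have hnt : Nontrivial V := Fintype.one_lt_card_iff_nontrivial.1 (by omega)
  have hconn : G.Connected := by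
    refine ⟨fun a b => ?_⟩
    obtain ⟨z, hz⟩ : ∃ z, z ∉ ({a, b} : Finset V) := by
      by_contra hc
      push Not at hc
      have h1 : ({a, b} : Finset V) = Finset.univ := Finset.eq_univ_iff_forall.2 hc
      have h3 := Finset.card_le_two (a := a) (b := b)
      rw [h1, Finset.card_univ] at h3
      omega
    simp only [Finset.mem_insert, Finset.mem_singleton, not_or] at hz
    have := (h2.2 z).preconnected ⟨a, Ne.symm hz.1⟩ ⟨b, Ne.symm hz.2⟩
    exact this.map (Embedding.induce _).toHom
  have hac : ¬ G.IsAcyclic := by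
    intro hac
    obtain ⟨v, hv⟩ := IsTree.exists_vert_degree_one_of_nontrivial ⟨hconn, hac⟩
    have := hδ v
    omega
  unfold IsAcyclic at hac
  push Not at hac
  obtain ⟨v, c, hc⟩ := hac
  have h3 := hc.three_le_length
  cases c with
  | nil => simp at h3
  | cons h p =>
    refine ⟨p.support, Pt.cyc (a := _) (b := v) ⟨p.isChain_adj_support, ?_, ?_⟩ h ?_ ?_⟩
    · rw [List.head?_eq_some_head p.support_ne_nil, p.head_support]
    · rw [List.getLast?_eq_some_getLast p.support_ne_nil, p.getLast_support]
    · simpa using hc.support_nodup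
    · simpa using h3

theorem exists_mx [Fintype V] (h : ∃ l, Cyc G l) : ∃ l, Mx G l := by
  by_contra hc
  have : ∀ k : ℕ, ∃ l, Cyc G l ∧ k ≤ l.length := by
    intro k
    induction k with
    | zero => obtain ⟨l, hl⟩ := h; exact ⟨l, hl, by simp⟩
    | succ k ih =>
      obtain ⟨l, hl, hk⟩ := ih
      by_contra h'
      push Not at h'
      exact hc ⟨l, hl, fun m hm => by have := h' m hm; omega⟩
  obtain ⟨l, hl, hk⟩ := this (Fintype.card V + 1)
  have := hl.1.length_le_card
  omega

theorem edge_notMem {a b : V} (p : G.Walk a b) (hp : p.IsPath) (h : 2 ≤ p.length) :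
    s(b, a) ∉ p.edges := by
  cases p with
  | nil => simp at h
  | cons h1 p =>
    rw [Walk.cons_isPath_iff] at hp
    rw [Walk.edges_cons, List.mem_cons, not_or]
    refine ⟨fun e => ?_, fun e => hp.2 (p.snd_mem_support_of_mem_edges e)⟩
    rw [Sym2.eq_iff] at e
    rcases e with ⟨e1, e2⟩ | ⟨e1, -⟩
    · exact h1.ne e2
    · subst e1
      have := (Walk.isPath_iff_nil.1 hp.1).eq_nil
      subst this
      simp at h

theorem Cyc.walk {l : List V} (hl : Cyc G l) :
    ∃ (v : V) (c : G.Walk v v), c.IsCycle ∧ c.length = l.length := by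
  have h3 := hl.2.1
  rcases l with _ | ⟨a, t⟩
  · simp at h3
  obtain ⟨b, hp, hba⟩ := hl.pt
  have hw : ∃ p : G.Walk a b, p.support = a :: t := by
    have e : (a :: t).getLast (by simp) = b := by
      have := hp.2.2
      rw [List.getLast?_eq_some_getLast (by simp)] at this
      simpa using this
    have h0 : (a :: t).head (List.cons_ne_nil a t) = a := List.head_cons
    refine ⟨(Walk.ofSupport (a :: t) (List.cons_ne_nil a t) hp.1).copy h0 e, ?_⟩
    exact (Walk.support_copy _ h0 e).trans (Walk.support_ofSupport _ _)
  obtain ⟨p, hps⟩ := hw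
  have hpl : p.length + 1 = (a :: t).length := by rw [← hps, Walk.length_support]
  have hpath : p.IsPath := Walk.IsPath.mk' (hps ▸ hl.1)
  refine ⟨b, Walk.cons hba p, ?_, by rw [Walk.length_cons, hpl]⟩
  rw [Walk.cons_isCycle_iff]
  exact ⟨hpath, edge_notMem p hpath (by omega)⟩

end Aux

/-- Every 2-connected [5,3]-graph of order `n ≥ 9` with minimum degree at least 3 is
Hamiltonian. -/
theorem stmt14 {V : Type*} [Fintype V] [DecidableEq V] (G : SimpleGraph V) [DecidableRel G.Adj]
    (h2 : TwoConnected G) (hst : IsSTGraph G 5 3) (hn : 9 ≤ Fintype.card V)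
    (hδ : ∀ v : V, 3 ≤ G.degree v) :
    ∃ (v : V) (c : G.Walk v v), c.IsCycle ∧ c.length = Fintype.card V := by
  obtain ⟨l, hM⟩ := exists_mx (exists_cyc h2 hn hδ)
  obtain ⟨v, c, hc, hlen⟩ := hM.1.walk
  refine ⟨v, c, hc, ?_⟩
  rw [hlen, ← List.toFinset_card_of_nodup hM.1.1, ← Finset.card_univ]
  congr 1
  exact Finset.eq_univ_iff_forall.2 fun w => List.mem_toFinset.2 (hM.spans h2 hst hn hδ w)
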